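/- arXiv:2507.13763 — 2 statements merged into one kernel-verified Lean document; each statement's English description precedes it below -/
import Mathlib

section
/- Let P be a convex-ranged probability charge on an algebra Σ and let v : Σ → ℝ be a P-invariant superadditive game. Then the following are equivalent: (i) the loose anticore LA_v is nonempty; (ii) sup LA_v exists in ba (setwise order); (iii) {a ∈ ℝ : a·P ≤ v setwise} is nonempty; (iv) a* := sup{a ∈ ℝ : a·P ≤ v setwise} is a real number. In this case, LA_v = {μ ∈ ba : μ ≤ a*·P} and sup LA_v = a*·P. -/
/-- A bounded signed charge on the algebra `S` of subsets of `Ω`: a finitely additive,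
bounded real-valued set function, normalised to vanish outside `S`. -/
structure Charge {Ω : Type*} (S : Set (Set Ω)) where
  toFun : Set Ω → ℝ
  zero_of_not_mem : ∀ A : Set Ω, A ∉ S → toFun A = 0
  additive : ∀ A B : Set Ω, A ∈ S → B ∈ S → Disjoint A B → toFun (A ∪ B) = toFun A + toFun B
  bounded : ∃ C : ℝ, ∀ A : Set Ω, |toFun A| ≤ C

namespace Charge

variable {Ω : Type*} {S : Set (Set Ω)}

theorem ext' {μ ν : Charge S} (h : μ.toFun = ν.toFun) : μ = ν := by
  cases μ; cases ν; simpa using h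

noncomputable instance : SMul ℝ (Charge S) :=
  ⟨fun a μ =>
    { toFun := fun A => a * μ.toFun A
      zero_of_not_mem := fun A hA => by
        show a * μ.toFun A = 0
        rw [μ.zero_of_not_mem A hA, mul_zero]
      additive := fun A B hA hB hAB => by
        show a * μ.toFun (A ∪ B) = a * μ.toFun A + a * μ.toFun B
        rw [μ.additive A B hA hB hAB]; ring
      bounded := by
        obtain ⟨C, hC⟩ := μ.bounded
        refine ⟨|a| * C, fun A => ?_⟩
        show |a * μ.toFun A| ≤ |a| * C
        rw [abs_mul]
        exact mul_le_mul_of_nonneg_left (hC A) (abs_nonneg a) }⟩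

@[simp] theorem smul_toFun (a : ℝ) (μ : Charge S) (A : Set Ω) :
    (a • μ).toFun A = a * μ.toFun A := rfl

/-- The setwise (partial) order on bounded charges. -/
instance : PartialOrder (Charge S) where
  le μ ν := ∀ A ∈ S, μ.toFun A ≤ ν.toFun A
  le_refl μ A _ := le_refl _
  le_trans μ ν ξ h1 h2 A hA := le_trans (h1 A hA) (h2 A hA)
  le_antisymm μ ν h1 h2 := ext' (funext fun A => by
    by_cases hA : A ∈ S
    · exact le_antisymm (h1 A hA) (h2 A hA)
    · rw [μ.zero_of_not_mem A hA, ν.zero_of_not_mem A hA])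

theorem le_def {μ ν : Charge S} : μ ≤ ν ↔ ∀ A ∈ S, μ.toFun A ≤ ν.toFun A := Iff.rfl

end Charge

/-- A probability charge: nonnegative, with total mass one. -/
def IsProbCharge {Ω : Type*} {S : Set (Set Ω)} (P : Charge S) : Prop :=
  P.toFun Set.univ = 1 ∧ ∀ A : Set Ω, 0 ≤ P.toFun A

/-- A charge `P` has convex range if for every `A ∈ S` the set of values `P(B)`,
`B ∈ S`, `B ⊆ A`, is the full interval `[0, P(A)]`. -/
def HasConvexRange {Ω : Type*} {S : Set (Set Ω)} (P : Charge S) : Prop :=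
  ∀ A ∈ S, {x : ℝ | ∃ B ∈ S, B ⊆ A ∧ P.toFun B = x} = Set.Icc 0 (P.toFun A)

/-- The loose anticore of a set function `v`. -/
def LooseAnticore {Ω : Type*} {S : Set (Set Ω)} (v : Set Ω → ℝ) : Set (Charge S) :=
  {μ | ∀ A ∈ S, μ.toFun A ≤ v A}

/-- The anticore of a set function `v`. -/
def Anticore {Ω : Type*} {S : Set (Set Ω)} (v : Set Ω → ℝ) : Set (Charge S) :=
  {μ | μ ∈ LooseAnticore v ∧ μ.toFun Set.univ = v Set.univ}

/-- The loose core of a set function `v`. -/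
def LooseCore {Ω : Type*} {S : Set (Set Ω)} (v : Set Ω → ℝ) : Set (Charge S) :=
  {μ | ∀ A ∈ S, v A ≤ μ.toFun A}

/-- The core of a set function `v`. -/
def Core {Ω : Type*} {S : Set (Set Ω)} (v : Set Ω → ℝ) : Set (Charge S) :=
  {μ | μ ∈ LooseCore v ∧ μ.toFun Set.univ = v Set.univ}

namespace Charge

variable {Ω : Type*} {S : Set (Set Ω)}

theorem toFun_empty (hS : MeasureTheory.IsSetAlgebra S) (μ : Charge S) : μ.toFun ∅ = 0 := by
  have h := μ.additive ∅ ∅ hS.empty_mem hS.empty_mem (Set.disjoint_empty _)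
  rw [Set.union_empty] at h
  linarith

theorem toFun_eq_add_sdiff (hS : MeasureTheory.IsSetAlgebra S) (μ : Charge S) {A B : Set Ω}
    (hA : A ∈ S) (hB : B ∈ S) (hBA : B ⊆ A) : μ.toFun A = μ.toFun B + μ.toFun (A \ B) := by
  rw [← μ.additive B (A \ B) hB (hS.sdiff_mem hA hB) Set.disjoint_sdiff_right,
    Set.union_sdiff_cancel hBA]

end Charge

section ConvexRange

variable {Ω : Type*} {S : Set (Set Ω)} {P : Charge S}

theorem HasConvexRange.exists_subset (hPcr : HasConvexRange P) {A : Set Ω} (hA : A ∈ S) {t : ℝ}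
    (h0 : 0 ≤ t) (h1 : t ≤ P.toFun A) : ∃ B ∈ S, B ⊆ A ∧ P.toFun B = t := by
  have h : t ∈ Set.Icc 0 (P.toFun A) := ⟨h0, h1⟩
  rwa [← hPcr A hA] at h

/-- A `P`-invariant game is a function `f` of the values of `P`, superadditive if the game is. -/
theorem HasConvexRange.exists_distortion (hS : MeasureTheory.IsSetAlgebra S)
    (hP : IsProbCharge P) (hPcr : HasConvexRange P) {v : Set Ω → ℝ}
    (hvinv : ∀ A ∈ S, ∀ B ∈ S, P.toFun A = P.toFun B → v A = v B)
    (hsuper : ∀ A ∈ S, ∀ B ∈ S, Disjoint A B → v A + v B ≤ v (A ∪ B)) :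
    ∃ f : ℝ → ℝ, (∀ A ∈ S, v A = f (P.toFun A)) ∧
      ∀ x y : ℝ, 0 ≤ x → 0 ≤ y → x + y ≤ 1 → f x + f y ≤ f (x + y) := by
  classical
  let f : ℝ → ℝ := fun t => if h : ∃ B ∈ S, P.toFun B = t then v h.choose else 0
  have hf : ∀ A ∈ S, v A = f (P.toFun A) := by
    intro A hA
    have h : ∃ B ∈ S, P.toFun B = P.toFun A := ⟨A, hA, rfl⟩
    simp only [f, dif_pos h]
    exact hvinv A hA _ h.choose_spec.1 h.choose_spec.2.symm
  refine ⟨f, hf, fun x y hx hy hxy => ?_⟩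
  obtain ⟨C, hC, -, hPC⟩ := hPcr.exists_subset hS.univ_mem (add_nonneg hx hy)
    (hxy.trans_eq hP.1.symm)
  obtain ⟨B, hB, hBC, hPB⟩ := hPcr.exists_subset hC hx (by linarith)
  have hD := hS.sdiff_mem hC hB
  have hPD : P.toFun (C \ B) = y := by
    have := P.toFun_eq_add_sdiff hS hC hB hBC
    linarith
  have h := hsuper B hB _ hD Set.disjoint_sdiff_right
  rwa [Set.union_sdiff_cancel hBC, hf B hB, hf _ hD, hf C hC, hPB, hPD, hPC] at h

theorem nat_mul_le_of_superadditive {f : ℝ → ℝ} (hf0 : f 0 = 0)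
    (hf : ∀ x y : ℝ, 0 ≤ x → 0 ≤ y → x + y ≤ 1 → f x + f y ≤ f (x + y))
    {x : ℝ} (hx : 0 ≤ x) (n : ℕ) (hn : n * x ≤ 1) : n * f x ≤ f (n * x) := by
  induction n with
  | zero => simp [hf0]
  | succ n ih =>
    push_cast at hn ⊢
    have h := hf (n * x) x (by positivity) hx (by linarith)
    have := ih (by linarith)
    rw [add_mul, one_mul, add_mul, one_mul]
    linarith

/-- Removing `n` pieces of `P`-mass `δ` from `A`. -/
theorem HasConvexRange.toFun_le_nat_mul_add (hS : MeasureTheory.IsSetAlgebra S)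
    (hPcr : HasConvexRange P) {f : ℝ → ℝ} {μ : Charge S}
    (hμ : ∀ A ∈ S, μ.toFun A ≤ f (P.toFun A)) {δ : ℝ} (hδ : 0 ≤ δ) (n : ℕ) :
    ∀ A ∈ S, n * δ ≤ P.toFun A → μ.toFun A ≤ n * f δ + f (P.toFun A - n * δ) := by
  induction n with
  | zero => intro A hA _; simpa using hμ A hA
  | succ n ih =>
    intro A hA hn
    push_cast at hn ⊢
    have hnδ : 0 ≤ n * δ := by positivity
    obtain ⟨B, hB, hBA, hPB⟩ := hPcr.exists_subset hA hδ (by linarith)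
    have hP := P.toFun_eq_add_sdiff hS hA hB hBA
    have h := ih (A \ B) (hS.sdiff_mem hA hB) (by linarith)
    have hμB := hμ B hB
    rw [hPB] at hμB
    rw [μ.toFun_eq_add_sdiff hS hA hB hBA,
      show P.toFun A - (n + 1) * δ = P.toFun (A \ B) - n * δ by linarith]
    linarith

theorem HasConvexRange.toFun_mul_le (hS : MeasureTheory.IsSetAlgebra S)
    (hP : IsProbCharge P) (hPcr : HasConvexRange P) {v : Set Ω → ℝ} (hv0 : v ∅ = 0)
    (hvinv : ∀ A ∈ S, ∀ B ∈ S, P.toFun A = P.toFun B → v A = v B)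
    (hsuper : ∀ A ∈ S, ∀ B ∈ S, Disjoint A B → v A + v B ≤ v (A ∪ B))
    {μ : Charge S} (hμ : μ ∈ LooseAnticore v) {A B : Set Ω} (hA : A ∈ S) (hB : B ∈ S)
    (hPB : 0 < P.toFun B) : μ.toFun A ≤ P.toFun A / P.toFun B * v B := by
  obtain ⟨f, hvf, hf⟩ := hPcr.exists_distortion hS hP hvinv hsuper
  have hf0 : f 0 = 0 := by
    simpa [P.toFun_empty hS, hv0] using (hvf ∅ hS.empty_mem).symm
  have hμf : ∀ A ∈ S, μ.toFun A ≤ f (P.toFun A) := fun A hA => (hμ A hA).trans_eq (hvf A hA)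
  have hP1 : P.toFun B ≤ 1 := by
    have h := P.toFun_eq_add_sdiff hS hS.univ_mem hB (Set.subset_univ B)
    have := hP.2 (Set.univ \ B)
    linarith [hP.1]
  obtain ⟨C, hC⟩ := μ.bounded
  have hbdd : ∀ y : ℝ, 0 ≤ y → y ≤ 1 → f y ≤ f 1 + C := by
    intro y hy0 hy1
    obtain ⟨D, hD, -, hPD⟩ := hPcr.exists_subset hS.univ_mem (sub_nonneg.2 hy1)
      (by linarith [hP.1])
    have h1 := hμf D hD
    have h2 := hf y (1 - y) hy0 (by linarith) (by linarith)
    rw [hPD] at h1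
    rw [add_sub_cancel] at h2
    linarith [neg_le_of_abs_le (hC D)]
  rw [hvf B hB]
  set p := P.toFun A with hp
  set x := P.toFun B with hx
  have hp0 : 0 ≤ p := hP.2 A
  have key : ∀ n : ℕ, 0 < n → n * (μ.toFun A - p / x * f x) ≤ |f x| + (f 1 + C) := by
    intro n hn
    have hn' : (0 : ℝ) < n := Nat.cast_pos.2 hn
    have hδ : 0 < x / n := by positivity
    set m := ⌊p / (x / n)⌋₊ with hm
    have hq : 0 ≤ p / (x / n) := by positivity
    have hm1 : (m : ℝ) ≤ p / (x / n) := Nat.floor_le hq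
    have hm2 : p / (x / n) < m + 1 := Nat.lt_floor_add_one _
    have hr1 : m * (x / n) ≤ p := (le_div_iff₀ hδ).1 hm1
    have hr2 : p < (m + 1) * (x / n) := (div_lt_iff₀ hδ).1 hm2
    have hnx : n * (x / n) = x := by field_simp
    set r := p - m * (x / n) with hr
    have hr0 : 0 ≤ r := sub_nonneg.2 hr1
    have hnr : n * r ≤ 1 := by
      have : n * r ≤ n * (x / n) := mul_le_mul_of_nonneg_left (by linarith) hn'.le
      linarith
    have h1 : μ.toFun A ≤ m * f (x / n) + f r :=
      hPcr.toFun_le_nat_mul_add hS hμf hδ.le m A hA hr1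
    have h2 := nat_mul_le_of_superadditive hf0 hf hδ.le n (by linarith)
    rw [hnx] at h2
    have h3 := (nat_mul_le_of_superadditive hf0 hf hr0 n hnr).trans
      (hbdd _ (by positivity) hnr)
    have h4 : n * (p / x) = p / (x / n) := by field_simp
    have h5 : (m - p / (x / n)) * f x ≤ |f x| := by
      refine (le_abs_self _).trans ?_
      rw [abs_mul]
      refine mul_le_of_le_one_left (abs_nonneg _) (abs_le.2 ⟨?_, ?_⟩) <;> linarith
    have h6 : m * (n * f (x / n)) ≤ m * f x := mul_le_mul_of_nonneg_left h2 m.cast_nonneg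
    calc n * (μ.toFun A - p / x * f x)
        = n * μ.toFun A - p / (x / n) * f x := by rw [← h4]; ring
      _ ≤ n * (m * f (x / n) + f r) - p / (x / n) * f x := by gcongr
      _ ≤ |f x| + (f 1 + C) := by linarith
  by_contra! hlt
  obtain ⟨n, hn⟩ := exists_nat_gt ((|f x| + (f 1 + C)) / (μ.toFun A - p / x * f x))
  rw [div_lt_iff₀ (sub_pos.2 hlt)] at hn
  have h := key (n + 1) n.succ_pos
  push_cast at h
  linarith

end ConvexRange

/-- For a `P`-invariant superadditive game `v` on an algebra `S` (with `P`
a convex-ranged probability charge), the following are equivalent: (i) the loose anticore is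
nonempty; (ii) its supremum exists in `ba`; (iii) `{a : ℝ | a•P ≤ v setwise}` is nonempty;
(iv) the supremum `a*` of that set is a real number (the set is nonempty and bounded above).
In that case `LA_v = {μ | μ ≤ a*•P}` and `sup LA_v = a*•P`. -/
theorem stmt8 {Ω : Type*} (S : Set (Set Ω)) (hS : MeasureTheory.IsSetAlgebra S)
    (P : Charge S) (hP : IsProbCharge P) (hPcr : HasConvexRange P)
    (v : Set Ω → ℝ) (hv0 : v ∅ = 0)
    (hvinv : ∀ A ∈ S, ∀ B ∈ S, P.toFun A = P.toFun B → v A = v B)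
    (hsuper : ∀ A ∈ S, ∀ B ∈ S, Disjoint A B → v A + v B ≤ v (A ∪ B)) :
    (((LooseAnticore v : Set (Charge S)).Nonempty ↔
        ∃ s : Charge S, IsLUB (LooseAnticore v) s) ∧
      ((LooseAnticore v : Set (Charge S)).Nonempty ↔
        {a : ℝ | ∀ A ∈ S, a * P.toFun A ≤ v A}.Nonempty) ∧
      ((LooseAnticore v : Set (Charge S)).Nonempty ↔
        ({a : ℝ | ∀ A ∈ S, a * P.toFun A ≤ v A}.Nonempty ∧
          BddAbove {a : ℝ | ∀ A ∈ S, a * P.toFun A ≤ v A}))) ∧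
    ((LooseAnticore v : Set (Charge S)).Nonempty →
      (LooseAnticore v : Set (Charge S)) =
        {μ : Charge S | μ ≤ sSup {a : ℝ | ∀ A ∈ S, a * P.toFun A ≤ v A} • P} ∧
      IsLUB (LooseAnticore v : Set (Charge S))
        (sSup {a : ℝ | ∀ A ∈ S, a * P.toFun A ≤ v A} • P)) := by
  set T := {a : ℝ | ∀ A ∈ S, a * P.toFun A ≤ v A} with hT
  have hnull : ∀ A ∈ S, P.toFun A = 0 → v A = 0 := fun A hA h => by
    rw [hvinv A hA ∅ hS.empty_mem (h.trans (P.toFun_empty hS).symm), hv0]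
  have hbdd : BddAbove T := ⟨v Set.univ, fun a ha => by
    simpa [hP.1] using ha _ hS.univ_mem⟩
  have hquot : ∀ μ ∈ (LooseAnticore v : Set (Charge S)), ∀ A ∈ S, 0 < P.toFun A →
      μ.toFun A / P.toFun A ∈ T := by
    intro μ hμ A hA hPA B hB
    rcases (hP.2 B).eq_or_lt with hPB | hPB
    · rw [← hPB, mul_zero, hnull B hB hPB.symm]
    · have h := hPcr.toFun_mul_le hS hP hv0 hvinv hsuper hμ hA hB hPB
      rw [div_mul_eq_mul_div, div_le_iff₀ hPA]
      rw [div_mul_eq_mul_div, le_div_iff₀ hPB] at h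
      linarith
  have hne : (LooseAnticore v : Set (Charge S)).Nonempty → T.Nonempty := fun ⟨μ, hμ⟩ =>
    ⟨_, hquot μ hμ Set.univ hS.univ_mem (by rw [hP.1]; exact one_pos)⟩
  have hne' : T.Nonempty → (LooseAnticore v : Set (Charge S)).Nonempty := fun ⟨a, ha⟩ =>
    ⟨a • P, ha⟩
  have hle : ∀ μ ∈ (LooseAnticore v : Set (Charge S)), μ ≤ sSup T • P := by
    intro μ hμ A hA
    rw [Charge.smul_toFun]
    rcases (hP.2 A).eq_or_lt with hPA | hPA
    · rw [← hPA, mul_zero, ← hnull A hA hPA.symm]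
      exact hμ A hA
    · exact (div_le_iff₀ hPA).1 (le_csSup hbdd (hquot μ hμ A hA hPA))
  have hmem : T.Nonempty → sSup T • P ∈ (LooseAnticore v : Set (Charge S)) := by
    intro h A hA
    rw [Charge.smul_toFun]
    rcases (hP.2 A).eq_or_lt with hPA | hPA
    · rw [← hPA, mul_zero, hnull A hA hPA.symm]
    · exact (le_div_iff₀ hPA).1 (csSup_le h fun a ha => (le_div_iff₀ hPA).2 (ha A hA))
  have hlub : (LooseAnticore v : Set (Charge S)).Nonempty →
      IsLUB (LooseAnticore v : Set (Charge S)) (sSup T • P) := fun h =>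
    IsGreatest.isLUB ⟨hmem (hne h), hle⟩
  refine ⟨⟨⟨fun h => ⟨_, hlub h⟩, ?_⟩, ⟨hne, hne'⟩, ⟨fun h => ⟨hne h, hbdd⟩, fun h => hne' h.1⟩⟩,
    fun h => ⟨?_, hlub h⟩⟩
  · rintro ⟨s, hs⟩
    by_contra hempty
    rw [Set.not_nonempty_iff_eq_empty] at hempty
    have h := hs.2 (show (s.toFun Set.univ - 1) • P ∈ upperBounds _ by simp [hempty])
      Set.univ hS.univ_mem
    rw [Charge.smul_toFun, hP.1] at h
    linarith
  · exact Set.Subset.antisymm hle fun μ hμ A hA => (hμ A hA).trans (hmem (hne h) A hA)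
end

section
/- Let P be a convex-ranged probability charge on an algebra Σ, let β ∈ [0,1), and define the game v_β(A) = min{P(A)/(1 − β), 1} for A ∈ Σ. Then sup A_{v_β}, sup LA_{v_β}, and inf LC_{v_β} all exist in ba (setwise order) and sup A_{v_β} = sup LA_{v_β} = inf LC_{v_β} = (1/(1 − β))·P. -/
namespace Charge

variable {Ω : Type*} {S : Set (Set Ω)}

theorem toFun_inter_add_diff (hS : MeasureTheory.IsSetAlgebra S) (μ : Charge S) {A B : Set Ω}
    (hA : A ∈ S) (hB : B ∈ S) : μ.toFun (A ∩ B) + μ.toFun (A \ B) = μ.toFun A := by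
  rw [← μ.additive _ _ (hS.inter_mem hA hB) (hS.sdiff_mem hA hB)
    (Set.disjoint_sdiff_right.mono_left Set.inter_subset_right), Set.inter_union_sdiff]

theorem toFun_add_diff (hS : MeasureTheory.IsSetAlgebra S) (μ : Charge S) {A B : Set Ω}
    (hA : A ∈ S) (hB : B ∈ S) (hBA : B ⊆ A) : μ.toFun B + μ.toFun (A \ B) = μ.toFun A := by
  have h := toFun_inter_add_diff hS μ hA hB
  rwa [Set.inter_eq_self_of_subset_right hBA] at h

open Classical in
/-- The trace `A ↦ μ (A ∩ D)` of a charge on a member `D` of the algebra. -/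
noncomputable def restrict (hS : MeasureTheory.IsSetAlgebra S) (μ : Charge S) (D : Set Ω)
    (hD : D ∈ S) : Charge S where
  toFun A := if A ∈ S then μ.toFun (A ∩ D) else 0
  zero_of_not_mem A hA := if_neg hA
  additive A B hA hB hAB := by
    rw [if_pos hA, if_pos hB, if_pos (hS.union_mem hA hB), Set.union_inter_distrib_right]
    exact μ.additive _ _ (hS.inter_mem hA hD) (hS.inter_mem hB hD)
      (hAB.mono Set.inter_subset_left Set.inter_subset_left)
  bounded := by
    obtain ⟨C, hC⟩ := μ.bounded
    refine ⟨C, fun A => ?_⟩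
    split_ifs
    · exact hC _
    · simpa using (abs_nonneg _).trans (hC ∅)

theorem restrict_toFun (hS : MeasureTheory.IsSetAlgebra S) (μ : Charge S) {D : Set Ω}
    (hD : D ∈ S) {A : Set Ω} (hA : A ∈ S) : (restrict hS μ D hD).toFun A = μ.toFun (A ∩ D) :=
  if_pos hA

/-- For a convex-ranged charge `P`, an inequality `c • P ≤ ν` need only be checked on sets of
`P`-mass at most `t`, for some `t > 0`. -/
theorem smul_le_of_forall_small (hS : MeasureTheory.IsSetAlgebra S) {P : Charge S}
    (hPcr : HasConvexRange P) {c t : ℝ} (ht : 0 < t) {ν : Charge S}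
    (h : ∀ B ∈ S, P.toFun B ≤ t → c * P.toFun B ≤ ν.toFun B) : c • P ≤ ν := by
  have key : ∀ n : ℕ, ∀ A ∈ S, P.toFun A ≤ (n + 1) * t → c * P.toFun A ≤ ν.toFun A := by
    intro n
    induction n with
    | zero => exact fun A hA hAt => h A hA (by simpa using hAt)
    | succ n ih =>
      intro A hA hAt
      rcases le_or_gt (P.toFun A) t with hle | hlt
      · exact h A hA hle
      have ht_mem : t ∈ {x : ℝ | ∃ B ∈ S, B ⊆ A ∧ P.toFun B = x} := by
        rw [hPcr A hA]
        exact ⟨ht.le, hlt.le⟩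
      obtain ⟨B, hB, hBA, hPB⟩ := ht_mem
      have hP := toFun_add_diff hS P hA hB hBA
      have hν := toFun_add_diff hS ν hA hB hBA
      have hsmall := h B hB hPB.le
      have hdiff := ih (A \ B) (hS.sdiff_mem hA hB) (by push_cast at hAt; linarith)
      rw [← hP, ← hν, mul_add]
      exact add_le_add hsmall hdiff
  intro A hA
  obtain ⟨n, hn⟩ := exists_nat_ge (P.toFun A / t)
  refine key n A hA ?_
  rw [div_le_iff₀ ht] at hn
  linarith

/-- Every set of mass at most `t ≤ P Ω` extends to a set of mass exactly `t`. -/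
theorem exists_superset_toFun_eq (hS : MeasureTheory.IsSetAlgebra S) {P : Charge S}
    (hPcr : HasConvexRange P) {t : ℝ} (ht : t ≤ P.toFun Set.univ) {B : Set Ω} (hB : B ∈ S)
    (hBt : P.toFun B ≤ t) : ∃ D ∈ S, B ⊆ D ∧ P.toFun D = t := by
  have hU := toFun_add_diff hS P hS.univ_mem hB (Set.subset_univ B)
  have hC : Set.univ \ B ∈ S := hS.sdiff_mem hS.univ_mem hB
  have hmem : t - P.toFun B ∈ {x : ℝ | ∃ E ∈ S, E ⊆ Set.univ \ B ∧ P.toFun E = x} := by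
    rw [hPcr _ hC]
    constructor <;> linarith
  obtain ⟨E, hE, hEB, hPE⟩ := hmem
  refine ⟨B ∪ E, hS.union_mem hB hE, Set.subset_union_left, ?_⟩
  rw [P.additive B E hB hE (Set.disjoint_sdiff_right.mono_right hEB), hPE]
  ring

end Charge

/-- For the Expected Shortfall game `v_β(A) = min{P(A)/(1 − β), 1}`
associated with a convex-ranged probability charge `P` and a level `β ∈ [0,1)`, the suprema
of the anticore and of the loose anticore and the infimum of the loose core all exist in
`ba` (setwise order) and coincide with `(1/(1 − β))·P`. -/
theorem stmt11 {Ω : Type*} (S : Set (Set Ω)) (hS : MeasureTheory.IsSetAlgebra S)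
    (P : Charge S) (hP : IsProbCharge P) (hPcr : HasConvexRange P)
    (β : ℝ) (hβ : β ∈ Set.Ico (0 : ℝ) 1) :
    IsLUB (Anticore (fun A => min (P.toFun A / (1 - β)) 1) : Set (Charge S))
      ((1 / (1 - β)) • P) ∧
    IsLUB (LooseAnticore (fun A => min (P.toFun A / (1 - β)) 1) : Set (Charge S))
      ((1 / (1 - β)) • P) ∧
    IsGLB (LooseCore (fun A => min (P.toFun A / (1 - β)) 1) : Set (Charge S))
      ((1 / (1 - β)) • P) := by
  have ht : 0 < 1 - β := sub_pos.2 hβ.2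
  have hv : ∀ A, P.toFun A / (1 - β) = 1 / (1 - β) * P.toFun A := fun A => by ring
  have hupper : (1 / (1 - β)) • P ∈ upperBounds
      (LooseAnticore (fun A => min (P.toFun A / (1 - β)) 1) : Set (Charge S)) :=
    fun μ hμ A hA => (hμ A hA).trans ((min_le_left _ _).trans_eq (hv A))
  have hsub : (Anticore (fun A => min (P.toFun A / (1 - β)) 1) : Set (Charge S)) ⊆
      LooseAnticore (fun A => min (P.toFun A / (1 - β)) 1) := fun μ hμ => hμ.1
  have hleast : (1 / (1 - β)) • P ∈ lowerBounds (upperBounds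
      (Anticore (fun A => min (P.toFun A / (1 - β)) 1) : Set (Charge S))) := by
    intro ν hν
    refine Charge.smul_le_of_forall_small hS hPcr ht fun B hB hBt => ?_
    obtain ⟨D, hD, hBD, hPD⟩ := Charge.exists_superset_toFun_eq hS hPcr
      (by rw [hP.1]; linarith [hβ.1]) hB hBt
    have hmem : (1 / (1 - β)) • Charge.restrict hS P D hD ∈
        (Anticore (fun A => min (P.toFun A / (1 - β)) 1) : Set (Charge S)) := by
      refine ⟨fun A hA => ?_, ?_⟩
      · have hA' := Charge.toFun_inter_add_diff hS P hA hD
        have hD' := Charge.toFun_inter_add_diff hS P hD hA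
        rw [Set.inter_comm] at hD'
        rw [Charge.smul_toFun, Charge.restrict_toFun hS P hD hA, ← hv]
        refine le_min ?_ ?_
        · exact div_le_div_of_nonneg_right (by linarith [hP.2 (A \ D)]) ht.le
        · rw [div_le_one ht]
          linarith [hP.2 (D \ A)]
      · rw [Charge.smul_toFun, Charge.restrict_toFun hS P hD hS.univ_mem, Set.univ_inter, hPD,
          one_div_mul_cancel ht.ne']
        refine (min_eq_right ?_).symm
        rw [hP.1, le_div_iff₀ ht]
        linarith [hβ.1]
    have hle := hν hmem B hB
    rwa [Charge.smul_toFun, Charge.restrict_toFun hS P hD hB,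
      Set.inter_eq_self_of_subset_left hBD] at hle
  refine ⟨⟨fun μ hμ => hupper (hsub hμ), hleast⟩,
    ⟨hupper, fun ν hν => hleast fun μ hμ => hν (hsub hμ)⟩, ?_, ?_⟩
  · intro μ hμ
    refine Charge.smul_le_of_forall_small hS hPcr ht fun B hB hBt => ?_
    have hB' : min (P.toFun B / (1 - β)) 1 ≤ μ.toFun B := hμ B hB
    rwa [min_eq_left ((div_le_one ht).2 hBt), hv] at hB'
  · exact fun ν hν => hν fun A _ => (min_le_left _ _).trans_eq (hv A)
end
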